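/- Let A be a polynomial vector field on ℂ^p, n ∈ ℕ^p a multi-index, and t ∈ ℂ with |t|·m(A) < 1. Setting y_i(t) := Σ_{k≥0} (t^k/k!)·coeff_0(D_A^k(z_i)) for i = 1,…,p, one has Σ_{k≥0} (t^k/k!)·coeff_0(D_A^k(z^n)) = y_1(t)^{n_1}·y_2(t)^{n_2}·…·y_p(t)^{n_p}, all series involved converging absolutely. -/

import Mathlib

open MvPolynomial

noncomputable def vfDeriv {p : ℕ} (A : Fin p → MvPolynomial (Fin p) ℂ)
    (P : MvPolynomial (Fin p) ℂ) : MvPolynomial (Fin p) ℂ :=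
  ∑ i, A i * pderiv i P

noncomputable def vfNorm {p : ℕ} (A : Fin p → MvPolynomial (Fin p) ℂ) : ℝ :=
  ⨆ i, ∑ m ∈ (A i).support, ‖(A i).coeff m‖

/-- The derivation associated with the polynomial vector field `A`. -/
noncomputable def vfDerivation {p : ℕ} (A : Fin p → MvPolynomial (Fin p) ℂ) :
    Derivation ℂ (MvPolynomial (Fin p) ℂ) (MvPolynomial (Fin p) ℂ) :=
  ∑ i, A i • pderiv i

/-- The `k`-th Taylor coefficient at time `0` of `P` along the flow of `A` started at the origin. -/
noncomputable def taylorCoeff {p : ℕ} (A : Fin p → MvPolynomial (Fin p) ℂ) (k : ℕ) :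
    MvPolynomial (Fin p) ℂ →ₗ[ℂ] ℂ :=
  ((k.factorial : ℂ)⁻¹) • lcoeff ℂ 0 ∘ₗ ((vfDerivation A).toLinearMap ^ k)

section

variable {p : ℕ} (A : Fin p → MvPolynomial (Fin p) ℂ)

lemma vfDerivation_apply (P : MvPolynomial (Fin p) ℂ) : vfDerivation A P = vfDeriv A P := by
  rw [vfDerivation, ← Derivation.coeFnAddMonoidHom_apply, map_sum, Finset.sum_apply]
  rfl

lemma taylorCoeff_apply (k : ℕ) (P : MvPolynomial (Fin p) ℂ) :
    taylorCoeff A k P = (k.factorial : ℂ)⁻¹ * coeff 0 ((vfDeriv A)^[k] P) := by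
  have : (vfDerivation A : MvPolynomial (Fin p) ℂ → MvPolynomial (Fin p) ℂ) = vfDeriv A :=
    funext (vfDerivation_apply A)
  simp [taylorCoeff, Module.End.pow_apply, this]

lemma taylorCoeff_zero (P : MvPolynomial (Fin p) ℂ) : taylorCoeff A 0 P = coeff 0 P := by
  simp [taylorCoeff_apply]

lemma succ_mul_taylorCoeff_succ (k : ℕ) (P : MvPolynomial (Fin p) ℂ) :
    ((k : ℂ) + 1) * taylorCoeff A (k + 1) P = taylorCoeff A k (vfDeriv A P) := by
  have h : ((k : ℂ) + 1) ≠ 0 := Nat.cast_add_one_ne_zero k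
  have h' : (k.factorial : ℂ) ≠ 0 := Nat.cast_ne_zero.2 k.factorial_ne_zero
  rw [taylorCoeff_apply, taylorCoeff_apply, Function.iterate_succ_apply, Nat.factorial_succ]
  push_cast
  field_simp

lemma vfDeriv_mul (P Q : MvPolynomial (Fin p) ℂ) :
    vfDeriv A (P * Q) = P * vfDeriv A Q + vfDeriv A P * Q := by
  simp only [← vfDerivation_apply, Derivation.leibniz, smul_eq_mul]
  ring

open Finset in
lemma taylorCoeff_mul (k : ℕ) (P Q : MvPolynomial (Fin p) ℂ) :
    taylorCoeff A k (P * Q) =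
      ∑ x ∈ antidiagonal k, taylorCoeff A x.1 P * taylorCoeff A x.2 Q := by
  induction k generalizing P Q with
  | zero => simp [taylorCoeff_zero, ← constantCoeff_eq]
  | succ k ih =>
    have h : ((k : ℂ) + 1) ≠ 0 := Nat.cast_add_one_ne_zero k
    apply mul_left_cancel₀ h
    rw [succ_mul_taylorCoeff_succ, vfDeriv_mul, map_add, ih, ih]
    have key : ((k : ℂ) + 1) *
        ∑ x ∈ antidiagonal (k + 1), taylorCoeff A x.1 P * taylorCoeff A x.2 Q =
        ∑ x ∈ antidiagonal (k + 1), taylorCoeff A x.1 P * ((x.2 : ℂ) * taylorCoeff A x.2 Q) +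
        ∑ x ∈ antidiagonal (k + 1), ((x.1 : ℂ) * taylorCoeff A x.1 P) * taylorCoeff A x.2 Q := by
      rw [mul_sum, ← sum_add_distrib]
      refine sum_congr rfl fun x hx => ?_
      have hx' : (x.1 : ℂ) + x.2 = k + 1 := by exact_mod_cast mem_antidiagonal.1 hx
      rw [← hx']
      ring
    rw [key, Nat.sum_antidiagonal_succ', Nat.sum_antidiagonal_succ]
    simp [succ_mul_taylorCoeff_succ]

lemma vfDeriv_monomial (m : Fin p →₀ ℕ) :
    vfDeriv A (monomial m 1) = ∑ i, ∑ l ∈ (A i).support,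
      ((m i : ℂ) * (A i).coeff l) • monomial (l + (m - Finsupp.single i 1)) (1 : ℂ) := by
  refine Finset.sum_congr rfl fun i _ => ?_
  conv_lhs => rw [(A i).as_sum]
  rw [pderiv_monomial, Finset.sum_mul]
  refine Finset.sum_congr rfl fun l _ => ?_
  rw [monomial_mul, smul_monomial]
  congr 1
  simp [mul_comm]

lemma succ_mul_taylorCoeff_succ_monomial (k : ℕ) (m : Fin p →₀ ℕ) :
    ((k : ℂ) + 1) * taylorCoeff A (k + 1) (monomial m 1) = ∑ i, ∑ l ∈ (A i).support,
      ((m i : ℂ) * (A i).coeff l) *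
        taylorCoeff A k (monomial (l + (m - Finsupp.single i 1)) 1) := by
  rw [succ_mul_taylorCoeff_succ, vfDeriv_monomial]
  simp only [map_sum, map_smul, smul_eq_mul]

lemma taylorCoeff_monomial_eq_zero {k : ℕ} {m : Fin p →₀ ℕ} (h : k < m.degree) :
    taylorCoeff A k (monomial m 1) = 0 := by
  induction k generalizing m with
  | zero =>
    have : m ≠ 0 := by rintro rfl; simp at h
    simp [taylorCoeff_zero, coeff_monomial, this]
  | succ k ih =>
    apply mul_left_cancel₀ (Nat.cast_add_one_ne_zero k : ((k : ℂ) + 1) ≠ 0)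
    rw [succ_mul_taylorCoeff_succ_monomial, mul_zero]
    refine Finset.sum_eq_zero fun i _ => Finset.sum_eq_zero fun l _ => ?_
    by_cases hi : m i = 0
    · simp [hi]
    · rw [ih, mul_zero]
      have hle : Finsupp.single i 1 ≤ m := by simpa using Nat.one_le_iff_ne_zero.2 hi
      have hdeg := congrArg Finsupp.degree (tsub_add_cancel_of_le hle)
      rw [map_add, Finsupp.degree_single] at hdeg
      rw [map_add]
      omega

lemma vfNorm_nonneg : 0 ≤ vfNorm A :=
  Real.iSup_nonneg fun _ => Finset.sum_nonneg fun _ _ => norm_nonneg _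

lemma sum_norm_coeff_le_vfNorm (i : Fin p) :
    ∑ m ∈ (A i).support, ‖(A i).coeff m‖ ≤ vfNorm A :=
  le_ciSup (f := fun i => ∑ m ∈ (A i).support, ‖(A i).coeff m‖) (Set.finite_range _).bddAbove i

lemma norm_taylorCoeff_monomial_le (k : ℕ) (m : Fin p →₀ ℕ) :
    ‖taylorCoeff A k (monomial m 1)‖ ≤ vfNorm A ^ k := by
  have hM := vfNorm_nonneg A
  induction k generalizing m with
  | zero =>
    rw [taylorCoeff_zero, coeff_monomial]
    split_ifs <;> simp
  | succ k ih =>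
    rcases lt_or_ge (k + 1) m.degree with h | h
    · rw [taylorCoeff_monomial_eq_zero A h, norm_zero]
      positivity
    have hk : (0 : ℝ) < (k : ℝ) + 1 := by positivity
    have hn : ‖(k : ℂ) + 1‖ = (k : ℝ) + 1 := by
      exact_mod_cast Complex.norm_natCast (k + 1)
    have hdeg : ∑ i, (m i : ℝ) ≤ (k : ℝ) + 1 := by
      rw [Finsupp.degree_eq_sum] at h
      exact_mod_cast h
    refine le_of_mul_le_mul_left ?_ hk
    calc ((k : ℝ) + 1) * ‖taylorCoeff A (k + 1) (monomial m 1)‖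
        = ‖∑ i, ∑ l ∈ (A i).support, ((m i : ℂ) * (A i).coeff l) *
            taylorCoeff A k (monomial (l + (m - Finsupp.single i 1)) 1)‖ := by
          rw [← succ_mul_taylorCoeff_succ_monomial, norm_mul, hn]
      _ ≤ ∑ i, ∑ l ∈ (A i).support, ((m i : ℝ) * ‖(A i).coeff l‖) * vfNorm A ^ k := by
          refine norm_sum_le_of_le _ fun i _ => norm_sum_le_of_le _ fun l _ => ?_
          rw [norm_mul, norm_mul, Complex.norm_natCast]
          gcongr
          exact ih _
      _ = ∑ i, (m i : ℝ) * (∑ l ∈ (A i).support, ‖(A i).coeff l‖) * vfNorm A ^ k := by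
          simp only [Finset.mul_sum, Finset.sum_mul]
      _ ≤ ∑ i, (m i : ℝ) * vfNorm A * vfNorm A ^ k := by
          gcongr with i
          exact sum_norm_coeff_le_vfNorm A i
      _ = (∑ i, (m i : ℝ)) * vfNorm A ^ (k + 1) := by
          rw [Finset.sum_mul]
          exact Finset.sum_congr rfl fun i _ => by ring
      _ ≤ ((k : ℝ) + 1) * vfNorm A ^ (k + 1) := by gcongr

variable {A} {t : ℂ}

lemma summable_norm_taylorCoeff_monomial (ht : ‖t‖ * vfNorm A < 1) (m : Fin p →₀ ℕ) :
    Summable fun k : ℕ => ‖t ^ k * taylorCoeff A k (monomial m 1)‖ := by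
  refine Summable.of_nonneg_of_le (fun _ => norm_nonneg _) (fun k => ?_)
    (summable_geometric_of_lt_one (mul_nonneg (norm_nonneg t) (vfNorm_nonneg A)) ht)
  rw [norm_mul, norm_pow, mul_pow]
  gcongr
  exact norm_taylorCoeff_monomial_le A k m

lemma summable_norm_taylorCoeff (ht : ‖t‖ * vfNorm A < 1) (P : MvPolynomial (Fin p) ℂ) :
    Summable fun k : ℕ => ‖t ^ k * taylorCoeff A k P‖ := by
  refine Summable.of_nonneg_of_le (fun _ => norm_nonneg _) (fun k => ?_)
    (summable_sum (s := P.support) fun m _ =>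
      (summable_norm_taylorCoeff_monomial ht m).mul_left ‖P.coeff m‖)
  conv_lhs => rw [P.as_sum, map_sum, Finset.mul_sum]
  refine norm_sum_le_of_le _ fun m _ => ?_
  have : monomial m (P.coeff m) = P.coeff m • monomial m (1 : ℂ) := by simp [smul_monomial]
  rw [this, map_smul, smul_eq_mul, mul_left_comm, norm_mul]

/-- Evaluation of polynomials along the flow of `A` started at the origin, as a multiplicative
map. -/
noncomputable def flowEval (ht : ‖t‖ * vfNorm A < 1) : MvPolynomial (Fin p) ℂ →* ℂ where
  toFun P := ∑' k : ℕ, t ^ k * taylorCoeff A k P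
  map_one' := by
    have h (k : ℕ) (hk : k ≠ 0) : t ^ k * taylorCoeff A k (1 : MvPolynomial (Fin p) ℂ) = 0 := by
      obtain ⟨j, rfl⟩ := Nat.exists_eq_succ_of_ne_zero hk
      have := succ_mul_taylorCoeff_succ A j 1
      rw [← vfDerivation_apply, Derivation.map_one_eq_zero, map_zero] at this
      simp [(mul_eq_zero.1 this).resolve_left (Nat.cast_add_one_ne_zero j)]
    rw [tsum_eq_single 0 h]
    simp [taylorCoeff_zero]
  map_mul' P Q := by
    rw [tsum_mul_tsum_eq_tsum_sum_antidiagonal_of_summable_norm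
      (summable_norm_taylorCoeff ht P) (summable_norm_taylorCoeff ht Q)]
    refine tsum_congr fun k => ?_
    rw [taylorCoeff_mul, Finset.mul_sum]
    refine Finset.sum_congr rfl fun x hx => ?_
    rw [← Finset.HasAntidiagonal.mem_antidiagonal.1 hx, pow_add]
    ring

end

/-- with `y_i(t) := Σ_{k≥0} (t^k/k!)·coeff_0(D_A^k(z_i))`, one has
`Σ_{k≥0} (t^k/k!)·coeff_0(D_A^k(z^n)) = Π_i y_i(t)^{n_i}`, all series converging
absolutely, whenever `|t|·m(A) < 1`. -/
theorem stmt_11 (p : ℕ) (hp : 0 < p) (A : Fin p → MvPolynomial (Fin p) ℂ)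
    (n : Fin p →₀ ℕ) (t : ℂ) (ht : ‖t‖ * vfNorm A < 1) :
    (Summable fun k : ℕ =>
      ‖(t ^ k / (Nat.factorial k : ℂ)) * coeff 0 ((vfDeriv A)^[k] (monomial n 1))‖) ∧
    (∀ i : Fin p, Summable fun k : ℕ =>
      ‖(t ^ k / (Nat.factorial k : ℂ)) * coeff 0 ((vfDeriv A)^[k] (X i))‖) ∧
    (∑' k : ℕ, (t ^ k / (Nat.factorial k : ℂ)) * coeff 0 ((vfDeriv A)^[k] (monomial n 1))) =
      ∏ i : Fin p,
        (∑' k : ℕ, (t ^ k / (Nat.factorial k : ℂ)) * coeff 0 ((vfDeriv A)^[k] (X i))) ^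
          (n i) := by
  have e (k : ℕ) (P : MvPolynomial (Fin p) ℂ) :
      (t ^ k / (Nat.factorial k : ℂ)) * coeff 0 ((vfDeriv A)^[k] P) =
        t ^ k * taylorCoeff A k P := by
    rw [taylorCoeff_apply, div_eq_mul_inv, mul_assoc]
  simp only [e]
  refine ⟨summable_norm_taylorCoeff ht _, fun i => summable_norm_taylorCoeff ht _, ?_⟩
  change flowEval ht (monomial n 1) = ∏ i, flowEval ht (X i) ^ n i
  rw [monomial_eq, C_1, one_mul, Finsupp.prod_fintype _ _ fun i => pow_zero _, map_prod]
  simp only [map_pow]
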